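/- arXiv:math/0403482 — 6 statements merged into one kernel-verified Lean document; each statement's English description precedes it below -/
import Mathlib

section
/- Assume 1 ≤ γ ≤ 2, 0 < v < 1, α > 0, k > 0, and let q = 1. Let c₁ > 0 and define H : (0,∞) → ℝ by H(t) = c₁/t. Then D[H](t) = 0 for all t > 0 if and only if (9γ/2)·[γv²/α + (v² − 1/2)(k²/v² − 1)]·c₁³ + 3·[(3/2 − v²)·k²/v² − 1 − γv²/α]·c₁² + (1/γ)·(1 − 3k²/v²)·c₁ + 2k²/(3γ²v²) = 0. -/
/-- The evolution operator for the Hubble rate of a spatially flat FLRW universe with a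
nonlinear causal viscous fluid, with parameters `γ, v, α, k, q`.  The powers
`H^(q-1)` and `H^(2-q)` are real exponentiation of the (positive) value `H t`. -/
noncomputable def Dop (γ v α k q : ℝ) (H : ℝ → ℝ) (t : ℝ) : ℝ :=
  (1 - k ^ 2 / v ^ 2 - (2 * k ^ 2 / (3 * γ * v ^ 2)) * deriv H t / (H t) ^ 2) *
      (deriv (deriv H) t + 3 * H t * deriv H t +
        ((1 - 2 * γ) / γ) * (deriv H t) ^ 2 / H t + (9 / 4) * γ * (H t) ^ 3) +
    (3 * γ * v ^ 2 / (2 * α)) * (1 + (α * k ^ 2 / (γ * v ^ 2)) * (H t) ^ (q - 1)) *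
      (H t) ^ (2 - q) * (2 * deriv H t + 3 * γ * (H t) ^ 2) -
    (9 / 2) * γ * v ^ 2 * (H t) ^ 3

theorem deriv_deriv_const_div (c t : ℝ) :
    deriv (deriv fun s : ℝ => c / s) t = 2 * c / t ^ 3 := by
  have h : (deriv fun s : ℝ => c / s) = fun s => -c * s ^ (-2 : ℤ) := by
    funext s
    rw [deriv_const_div_id, div_eq_mul_inv, zpow_neg]
    norm_cast
  rw [h, deriv_const_mul_field, deriv_zpow, div_eq_mul_inv, ← zpow_natCast, ← zpow_neg]
  norm_num
  ring

/-- At `q = 1` the operator maps `c / t` to a cubic polynomial in `c`, divided by `t ^ 3`. -/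
theorem Dop_const_div {γ v α c t : ℝ} (k : ℝ) (hγ : γ ≠ 0) (hv : v ≠ 0) (hα : α ≠ 0)
    (hc : c ≠ 0) (ht : t ≠ 0) :
    Dop γ v α k 1 (fun s => c / s) t =
      ((9 * γ / 2) * (γ * v ^ 2 / α + (v ^ 2 - 1 / 2) * (k ^ 2 / v ^ 2 - 1)) * c ^ 3 +
        3 * ((3 / 2 - v ^ 2) * (k ^ 2 / v ^ 2) - 1 - γ * v ^ 2 / α) * c ^ 2 +
        (1 / γ) * (1 - 3 * k ^ 2 / v ^ 2) * c +
        2 * k ^ 2 / (3 * γ ^ 2 * v ^ 2)) / t ^ 3 := by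
  have h₁ : (2 - 1 : ℝ) = 1 := by norm_num
  simp only [Dop, deriv_const_div_id, deriv_deriv_const_div, sub_self, h₁, Real.rpow_zero,
    Real.rpow_one]
  field_simp
  ring

/-- For `q = 1`, `H t = c₁/t` (with `c₁ > 0`) solves `D[H] = 0` on `(0,∞)` iff `c₁` is a
root of the stated cubic. -/
theorem stmt6 (γ v α k q : ℝ) (hγ₁ : 1 ≤ γ) (hγ₂ : γ ≤ 2) (hv₀ : 0 < v) (hv₁ : v < 1)
    (hα : 0 < α) (hk : 0 < k) (hq : q = 1) (c₁ : ℝ) (hc₁ : 0 < c₁)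
    (H : ℝ → ℝ) (hH : ∀ t : ℝ, H t = c₁ / t) :
    (∀ t : ℝ, 0 < t → Dop γ v α k q H t = 0) ↔
      (9 * γ / 2) * (γ * v ^ 2 / α + (v ^ 2 - 1 / 2) * (k ^ 2 / v ^ 2 - 1)) * c₁ ^ 3 +
        3 * ((3 / 2 - v ^ 2) * (k ^ 2 / v ^ 2) - 1 - γ * v ^ 2 / α) * c₁ ^ 2 +
        (1 / γ) * (1 - 3 * k ^ 2 / v ^ 2) * c₁ +
        2 * k ^ 2 / (3 * γ ^ 2 * v ^ 2) = 0 := by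
  obtain rfl : H = fun s => c₁ / s := funext hH
  subst hq
  have hD {t : ℝ} (ht : 0 < t) :=
    Dop_const_div k (zero_lt_one.trans_le hγ₁).ne' hv₀.ne' hα.ne' hc₁.ne' ht.ne'
  constructor
  · intro h
    simpa only [hD one_pos, one_pow, div_one] using h 1 one_pos
  · intro h t ht
    rw [hD ht, h, zero_div]
end

section
/- Assume 1 ≤ γ ≤ 2, 0 < v < 1, α > 0, k > 0, and q ∈ ℝ. Let c₁ > 0 and H(t) = c₁/t for t > 0. Then for all t > 0, D[H](t) = (3γv²/(2α))·c₁^{3−q}·(3γc₁ − 2)·t^{q−4} + P(c₁)·t^{−3}, where P(c) = (9γ/2)·(v² − 1/2)·(k²/v² − 1)·c³ + 3·[(3/2 − v²)·k²/v² − 1]·c² + (1/γ)·(1 − 3k²/v²)·c + 2k²/(3γ²v²), and c₁^{3−q}, t^{q−4} denote real exponentiation of positive bases. -/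
/-- The cubic `P(c)` whose roots give leading coefficients of the `t⁻¹` family. -/
noncomputable def Pcubic (γ v k : ℝ) (c : ℝ) : ℝ :=
  (9 * γ / 2) * (v ^ 2 - 1 / 2) * (k ^ 2 / v ^ 2 - 1) * c ^ 3 +
    3 * ((3 / 2 - v ^ 2) * (k ^ 2 / v ^ 2) - 1) * c ^ 2 +
    (1 / γ) * (1 - 3 * k ^ 2 / v ^ 2) * c + 2 * k ^ 2 / (3 * γ ^ 2 * v ^ 2)

/-- Substituting `H t = c₁/t` into the operator `D` gives exactly
`(3γv²/(2α)) c₁^{3−q} (3γc₁ − 2) t^{q−4} + P(c₁) t^{−3}` for `t > 0`. -/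
theorem stmt7 (γ v α k q : ℝ) (hγ₁ : 1 ≤ γ) (hγ₂ : γ ≤ 2) (hv₀ : 0 < v) (hv₁ : v < 1)
    (hα : 0 < α) (hk : 0 < k) (c₁ : ℝ) (hc₁ : 0 < c₁)
    (H : ℝ → ℝ) (hH : ∀ t : ℝ, H t = c₁ / t) :
    ∀ t : ℝ, 0 < t →
      Dop γ v α k q H t =
        (3 * γ * v ^ 2 / (2 * α)) * c₁ ^ (3 - q) * (3 * γ * c₁ - 2) * t ^ (q - 4) +
          Pcubic γ v k c₁ * t ^ (-3 : ℝ) := by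
  intro t ht
  obtain rfl : H = fun t => c₁ / t := funext hH
  have hd (x : ℝ) : deriv (fun t => c₁ / t) x = -c₁ / x ^ 2 := by
    simp only [div_eq_mul_inv, deriv_const_mul_field', deriv_inv']
    ring
  have hdd : deriv (deriv fun t => c₁ / t) t = 2 * c₁ / t ^ 3 := by
    rw [funext hd]
    have h := ((hasDerivAt_pow 2 t).fun_inv (by positivity)).const_mul (-c₁)
    simp only [← div_eq_mul_inv] at h
    rw [h.deriv]
    field_simp
    norm_num [mul_comm]
  have hpos : 0 < c₁ / t := by positivity
  have hmul : (c₁ / t) ^ (q - 1) * (c₁ / t) ^ (2 - q) = c₁ / t := by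
    rw [← Real.rpow_add hpos, show q - 1 + (2 - q) = 1 by ring, Real.rpow_one]
  have hdiv : (c₁ / t) ^ (2 - q) = c₁ ^ (2 - q) * t ^ (q - 2) := by
    rw [Real.div_rpow hc₁.le ht.le, div_eq_mul_inv, ← Real.rpow_neg ht.le, neg_sub]
  have hc : c₁ ^ (3 - q) = c₁ ^ (2 - q) * c₁ := by
    rw [show 3 - q = 2 - q + 1 by ring, Real.rpow_add_one hc₁.ne']
  have htq : t ^ (q - 4) = t ^ (q - 2) / t ^ 2 := by
    rw [show q - 4 = q - 2 - (2 : ℕ) by push_cast; ring, Real.rpow_sub_natCast ht.ne']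
  have ht3 : t ^ (-3 : ℝ) = (t ^ 3)⁻¹ := by
    rw [Real.rpow_neg ht.le]
    norm_cast
  have hsplit : (1 + α * k ^ 2 / (γ * v ^ 2) * (c₁ / t) ^ (q - 1)) * (c₁ / t) ^ (2 - q) =
      c₁ ^ (2 - q) * t ^ (q - 2) + α * k ^ 2 / (γ * v ^ 2) * (c₁ / t) := by
    rw [add_mul, one_mul, mul_assoc, hmul, hdiv]
  have hγ : γ ≠ 0 := by positivity
  simp only [Dop, Pcubic]
  rw [mul_assoc (3 * γ * v ^ 2 / (2 * α)) (1 + _), hsplit, hdd, hd, hc, htq, ht3]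
  field_simp
  ring
end

section
/- Assume 1 ≤ γ ≤ 2, 0 < v < 1, α > 0, k > 0, and q < 1. Let H(t) = 2/(3γt) for t > 0. Then D[H](t) = P(2/(3γ))·t^{−3} for all t > 0, where P(c) = (9γ/2)·(v² − 1/2)·(k²/v² − 1)·c³ + 3·[(3/2 − v²)·k²/v² − 1]·c² + (1/γ)·(1 − 3k²/v²)·c + 2k²/(3γ²v²); in particular, t^{4−q}·D[H](t) → 0 as t → 0⁺. -/
open Filter Topology

theorem deriv_const_div_fun_id (c : ℝ) : deriv (fun s : ℝ => c / s) = fun t => -c / t ^ 2 := by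
  funext t
  simp [div_eq_mul_inv]

theorem deriv_deriv_const_div_id (c : ℝ) {t : ℝ} (ht : t ≠ 0) :
    deriv (deriv fun s : ℝ => c / s) t = 2 * c / t ^ 3 := by
  rw [deriv_const_div_fun_id]
  have h : HasDerivAt (fun s : ℝ => -c / s ^ 2)
      ((0 * t ^ 2 - -c * (↑2 * t ^ (2 - 1))) / (t ^ 2) ^ 2) t :=
    (hasDerivAt_const t (-c)).div (hasDerivAt_pow 2 t) (pow_ne_zero 2 ht)
  rw [h.deriv]
  field_simp
  ring

/-- On `H t = 2 / (3γt)` the operator is exactly a `t⁻³` monomial with coefficient `P(2/(3γ))`. -/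
theorem Dop_two_div_three_mul (γ v α k q : ℝ) (hγ : γ ≠ 0) (hv : v ≠ 0) {t : ℝ} (ht : t ≠ 0) :
    Dop γ v α k q (fun s => 2 / (3 * γ) / s) t = Pcubic γ v k (2 / (3 * γ)) / t ^ 3 := by
  unfold Dop Pcubic
  rw [deriv_deriv_const_div_id _ ht, deriv_const_div_fun_id]
  have hzero : 2 * (-(2 / (3 * γ)) / t ^ 2) + 3 * γ * (2 / (3 * γ) / t) ^ 2 = 0 := by
    field_simp
    ring
  simp only [hzero, mul_zero, add_zero]
  field_simp
  ring

/-- For `q < 1`, `H t = 2/(3γt)` gives `D[H] t = P(2/(3γ)) t^{−3}` on `(0,∞)`; in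
particular `t^{4−q} D[H] t → 0` as `t → 0⁺`. -/
theorem stmt8 (γ v α k q : ℝ) (hγ₁ : 1 ≤ γ) (hγ₂ : γ ≤ 2) (hv₀ : 0 < v) (hv₁ : v < 1)
    (hα : 0 < α) (hk : 0 < k) (hq : q < 1)
    (H : ℝ → ℝ) (hH : ∀ t : ℝ, H t = 2 / (3 * γ * t)) :
    (∀ t : ℝ, 0 < t →
        Dop γ v α k q H t = Pcubic γ v k (2 / (3 * γ)) * t ^ (-3 : ℝ)) ∧
      Tendsto (fun t : ℝ => t ^ (4 - q) * Dop γ v α k q H t)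
        (nhdsWithin 0 (Set.Ioi (0 : ℝ))) (nhds 0) := by
  obtain rfl : H = fun s => 2 / (3 * γ) / s := by
    funext t
    rw [hH, div_div]
  have key : ∀ t : ℝ, 0 < t → Dop γ v α k q (fun s => 2 / (3 * γ) / s) t =
      Pcubic γ v k (2 / (3 * γ)) * t ^ (-3 : ℝ) := fun t ht => by
    rw [Dop_two_div_three_mul γ v α k q (by positivity) hv₀.ne' ht.ne', Real.rpow_neg ht.le,
      div_eq_mul_inv]
    norm_cast
  refine ⟨key, ?_⟩
  have hlim : Tendsto (fun t : ℝ => Pcubic γ v k (2 / (3 * γ)) * t ^ (1 - q))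
      (𝓝[>] 0) (𝓝 0) := by
    have h := ((Real.continuousAt_rpow_const 0 (1 - q) (Or.inr (by linarith))).tendsto.const_mul
      (Pcubic γ v k (2 / (3 * γ)))).mono_left (nhdsWithin_le_nhds (s := Set.Ioi 0))
    rwa [Real.zero_rpow (by linarith), mul_zero] at h
  refine hlim.congr' ?_
  filter_upwards [self_mem_nhdsWithin] with t ht
  rw [key t ht, mul_left_comm, ← Real.rpow_add ht]
  ring_nf
end

section
/- Assume γ > 0, 0 < v < 1 with v ≠ 1/√2, and k > 0 with k ≠ v. Define the cubic P(c) = (9γ/2)·(v² − 1/2)·(k²/v² − 1)·c³ + 3·[(3/2 − v²)·k²/v² − 1]·c² + (1/γ)·(1 − 3k²/v²)·c + 2k²/(3γ²v²). Then for a real number c, P(c) = 0 if and only if c = 2k²/(3γ(k² − v²)) or c = 2/(3γ(1 + √2·v)) or c = 2/(3γ(1 − √2·v)). -/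
/-- The cubic `Pcubic γ v k` splits into linear factors over the reals. -/
theorem Pcubic_eq_prod {γ v : ℝ} (hγ : γ ≠ 0) (hv : v ≠ 0) (k c : ℝ) :
    Pcubic γ v k c = -(1 / (12 * γ ^ 2 * v ^ 2)) *
      ((c * (3 * γ * (k ^ 2 - v ^ 2)) - 2 * k ^ 2) *
        ((c * (3 * γ * (1 + Real.sqrt 2 * v)) - 2) *
          (c * (3 * γ * (1 - Real.sqrt 2 * v)) - 2))) := by
  have h2 : Real.sqrt 2 ^ 2 = 2 := Real.sq_sqrt (by norm_num)
  have hquad : (c * (3 * γ * (1 + Real.sqrt 2 * v)) - 2) *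
      (c * (3 * γ * (1 - Real.sqrt 2 * v)) - 2) =
      9 * γ ^ 2 * (1 - 2 * v ^ 2) * c ^ 2 - 12 * γ * c + 4 := by
    linear_combination -9 * γ ^ 2 * v ^ 2 * c ^ 2 * h2
  rw [hquad, Pcubic]
  field_simp
  ring

/-- For `γ > 0`, `0 < v < 1` with `v ≠ 1/√2` and `k > 0` with `k ≠ v`, the roots of the
cubic `P` are exactly `2k²/(3γ(k²−v²))`, `2/(3γ(1+√2 v))` and `2/(3γ(1−√2 v))`. -/
theorem stmt9 (γ v k : ℝ) (hγ : 0 < γ) (hv₀ : 0 < v) (hv₁ : v < 1)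
    (hv₂ : v ≠ 1 / Real.sqrt 2) (hk : 0 < k) (hkv : k ≠ v) (c : ℝ) :
    Pcubic γ v k c = 0 ↔
      c = 2 * k ^ 2 / (3 * γ * (k ^ 2 - v ^ 2)) ∨
      c = 2 / (3 * γ * (1 + Real.sqrt 2 * v)) ∨
      c = 2 / (3 * γ * (1 - Real.sqrt 2 * v)) := by
  have hs : 0 < Real.sqrt 2 := by positivity
  have hkv' : k ^ 2 - v ^ 2 ≠ 0 :=
    sub_ne_zero.mpr fun h => hkv ((sq_eq_sq₀ hk.le hv₀.le).mp h)
  have hplus : 1 + Real.sqrt 2 * v ≠ 0 := by positivity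
  have hminus : 1 - Real.sqrt 2 * v ≠ 0 := fun h =>
    hv₂ ((eq_div_iff hs.ne').mpr (by linarith))
  have h3γ : 3 * γ ≠ 0 := by positivity
  have hlead : -(1 / (12 * γ ^ 2 * v ^ 2)) ≠ 0 := neg_ne_zero.mpr (by positivity)
  rw [Pcubic_eq_prod hγ.ne' hv₀.ne', eq_div_iff (mul_ne_zero h3γ hkv'),
    eq_div_iff (mul_ne_zero h3γ hplus), eq_div_iff (mul_ne_zero h3γ hminus)]
  simp only [mul_eq_zero_iff_left hlead, mul_eq_zero (M₀ := ℝ) (a := _ - _), sub_eq_zero]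
end

section
/- Assume 1 ≤ γ ≤ 2, 0 < v < 1, α > 0, k > 0, and q < 1. Set c₂ = (α/(γ(2−q)))·(2/(3γ))^{q} and define H(t) = 2/(3γt) + c₂·t^{−q} for t > 0. Then H(t) > 0 for all sufficiently small t > 0, and t³·D[H](t) → 0 as t → 0⁺. -/
open Filter Topology

/-- The rescaled operator `t ^ 3 * D[H] t` on `H t = (a + c u) / t`, as a function of
`u = t ^ (1 - q)`. -/
noncomputable def rescaledDop (γ v α k q a c u : ℝ) : ℝ :=
  (1 - k ^ 2 / v ^ 2 - (2 * k ^ 2 / (3 * γ * v ^ 2)) * (-(a + q * c * u)) / (a + c * u) ^ 2) *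
      (2 * a + q * (q + 1) * c * u - 3 * (a + c * u) * (a + q * c * u) +
        ((1 - 2 * γ) / γ) * (a + q * c * u) ^ 2 / (a + c * u) + (9 / 4) * γ * (a + c * u) ^ 3) +
    (3 * γ * v ^ 2 / (2 * α)) * (1 + (α * k ^ 2 / (γ * v ^ 2)) * (u * (a + c * u) ^ (q - 1))) *
      (a + c * u) ^ (2 - q) * ((4 - 2 * q) * c + 3 * γ * c ^ 2 * u) -
    (9 / 2) * γ * v ^ 2 * (a + c * u) ^ 3

theorem continuousAt_rescaledDop_zero {γ v α k q a c : ℝ} (ha : 0 < a) :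
    ContinuousAt (rescaledDop γ v α k q a c) 0 := by
  have h0 : a + c * 0 ≠ 0 := by simpa using ha.ne'
  have h : ContinuousAt (fun u : ℝ => a + c * u) 0 := by fun_prop
  have h1 := h.rpow_const (p := q - 1) (Or.inl h0)
  have h2 := h.rpow_const (p := 2 - q) (Or.inl h0)
  have h3 : ContinuousAt (fun u : ℝ => (1 - k ^ 2 / v ^ 2 -
      (2 * k ^ 2 / (3 * γ * v ^ 2)) * (-(a + q * c * u)) / (a + c * u) ^ 2)) 0 :=
    continuousAt_const.sub (ContinuousAt.div (by fun_prop) (h.pow 2) (pow_ne_zero 2 h0))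
  have h4 : ContinuousAt (fun u : ℝ => ((1 - 2 * γ) / γ) * (a + q * c * u) ^ 2 / (a + c * u)) 0 :=
    ContinuousAt.div (by fun_prop) h h0
  have h5 : ContinuousAt (fun u : ℝ => 2 * a + q * (q + 1) * c * u -
      3 * (a + c * u) * (a + q * c * u)) 0 := by fun_prop
  have h6 : ContinuousAt (fun u : ℝ => (4 - 2 * q) * c + 3 * γ * c ^ 2 * u) 0 := by fun_prop
  exact ((h3.mul ((h5.add h4).add (continuousAt_const.mul (h.pow 3)))).add
    (((continuousAt_const.mul (continuousAt_const.add (continuousAt_const.mul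
      (continuousAt_id.mul h1)))).mul h2).mul h6)).sub (continuousAt_const.mul (h.pow 3))

theorem rescaledDop_zero {γ v α k q : ℝ} (hγ : 0 < γ) (hα : 0 < α) (hq : q < 1) :
    rescaledDop γ v α k q (2 / (3 * γ)) ((α / (γ * (2 - q))) * (2 / (3 * γ)) ^ q) 0 = 0 := by
  have ha : 0 < 2 / (3 * γ) := by positivity
  have hq2 : 2 - q ≠ 0 := by linarith
  have hpow : (2 / (3 * γ)) ^ (2 - q) * (2 / (3 * γ)) ^ q = (2 / (3 * γ)) ^ 2 := by
    rw [← Real.rpow_add ha, sub_add_cancel, Real.rpow_two]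
  have hbr : 2 * (2 / (3 * γ)) - 3 * (2 / (3 * γ)) * (2 / (3 * γ)) +
      ((1 - 2 * γ) / γ) * (2 / (3 * γ)) ^ 2 / (2 / (3 * γ)) +
        (9 / 4) * γ * (2 / (3 * γ)) ^ 3 = 0 := by
    field_simp
    ring
  have hlin : (3 * γ * v ^ 2 / (2 * α)) * (2 / (3 * γ)) ^ (2 - q) *
      ((4 - 2 * q) * ((α / (γ * (2 - q))) * (2 / (3 * γ)) ^ q)) =
        (9 / 2) * γ * v ^ 2 * (2 / (3 * γ)) ^ 3 := by
    calc _ = (3 * γ * v ^ 2 / (2 * α)) * ((4 - 2 * q) * (α / (γ * (2 - q)))) *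
          ((2 / (3 * γ)) ^ (2 - q) * (2 / (3 * γ)) ^ q) := by ring
      _ = _ := by
        rw [hpow]
        field_simp
        ring
  simp only [rescaledDop, mul_zero, zero_mul, add_zero, mul_one]
  rw [hbr, hlin]
  ring

theorem hasDerivAt_div_add_mul_rpow {a c p t : ℝ} (n : ℕ) (ht : 0 < t) :
    HasDerivAt (fun s : ℝ => a / s ^ n + c * s ^ p)
      (-(n * a) / t ^ (n + 1) + p * c * t ^ (p - 1)) t := by
  have h1 := ((hasDerivAt_pow n t).fun_inv (pow_ne_zero n ht.ne')).const_mul a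
  have h2 := (Real.hasDerivAt_rpow_const (p := p) (Or.inl ht.ne')).const_mul c
  refine (h1.fun_add h2).congr_deriv ?_
  have ht' := ht.ne'
  rcases n with _ | n
  · simp
    ring
  · simp only [Nat.add_sub_cancel]
    field_simp
    ring

theorem cube_mul_Dop_eq_rescaledDop {γ v α k q a c t : ℝ} {H : ℝ → ℝ} (ha : 0 < a)
    (hc : 0 < c) (haγ : 3 * γ * a = 2) (ht : 0 < t) (hH : ∀ s : ℝ, H s = a / s + c * s ^ (-q)) :
    t ^ 3 * Dop γ v α k q H t = rescaledDop γ v α k q a c (t ^ (1 - q)) := by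
  have hd : ∀ s : ℝ, 0 < s → deriv H s = -a / s ^ 2 + -q * c * s ^ (-q - 1) := fun s hs => by
    have h := (hasDerivAt_div_add_mul_rpow (a := a) (c := c) (p := -q) 1 hs).deriv
    rw [show H = fun s : ℝ => a / s ^ 1 + c * s ^ (-q) by funext x; rw [hH, pow_one], h]
    norm_num
  have hdd : deriv (deriv H) t = 2 * a / t ^ 3 + (-q - 1) * (-q * c) * t ^ (-q - 1 - 1) := by
    have he : deriv H =ᶠ[𝓝 t] fun s => -a / s ^ 2 + -q * c * s ^ (-q - 1) :=
      (eventually_gt_nhds ht).mono hd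
    rw [he.deriv_eq, (hasDerivAt_div_add_mul_rpow 2 ht).deriv]
    norm_num
  have hu : 0 < t ^ (1 - q) := Real.rpow_pos_of_pos ht _
  have ht' := ht.ne'
  have e0 : t ^ (-q) = t ^ (1 - q) / t := by
    rw [← Real.rpow_sub_one ht']; ring_nf
  have e1 : t ^ (-q - 1) = t ^ (1 - q) / t ^ 2 := by
    rw [Real.rpow_sub_one ht', e0]; field_simp
  have e2 : t ^ (-q - 1 - 1) = t ^ (1 - q) / t ^ 3 := by
    rw [Real.rpow_sub_one ht', e1]; field_simp
  have f1 : t ^ (q - 1) = (t ^ (1 - q))⁻¹ := by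
    rw [← Real.rpow_neg ht.le]; ring_nf
  have f2 : t ^ (2 - q) = t * t ^ (1 - q) := by
    rw [mul_comm, ← Real.rpow_add_one ht']; ring_nf
  have hHt : H t = (a + c * t ^ (1 - q)) / t := by rw [hH, e0]; ring
  rw [Dop, hd t ht, hdd, e1, e2, hHt]
  set u := t ^ (1 - q)
  have hh : 0 < a + c * u := by positivity
  rw [Real.div_rpow hh.le ht.le, Real.div_rpow hh.le ht.le, f1, f2, rescaledDop]
  have hu' := hu.ne'
  have hh' := hh.ne'
  have hlin : 2 * (-a / t ^ 2 + -q * c * (u / t ^ 2)) + 3 * γ * ((a + c * u) / t) ^ 2 =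
      u * ((4 - 2 * q) * c + 3 * γ * c ^ 2 * u) / t ^ 2 := by
    field_simp
    linear_combination (a + 2 * c * u) * haγ
  have hpre : (-a / t ^ 2 + -q * c * (u / t ^ 2)) = -(a + q * c * u) / t ^ 2 := by ring
  have hsq : ∀ x : ℝ, x * (-(a + q * c * u) / t ^ 2) / ((a + c * u) / t) ^ 2 =
      x * (-(a + q * c * u)) / (a + c * u) ^ 2 := fun x => by field_simp
  have hbr : t ^ 3 * (2 * a / t ^ 3 + (-q - 1) * (-q * c) * (u / t ^ 3) +
      3 * ((a + c * u) / t) * (-(a + q * c * u) / t ^ 2) +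
      (1 - 2 * γ) / γ * (-(a + q * c * u) / t ^ 2) ^ 2 / ((a + c * u) / t) +
      9 / 4 * γ * ((a + c * u) / t) ^ 3) =
      2 * a + q * (q + 1) * c * u - 3 * (a + c * u) * (a + q * c * u) +
        ((1 - 2 * γ) / γ) * (a + q * c * u) ^ 2 / (a + c * u) +
          (9 / 4) * γ * (a + c * u) ^ 3 := by
    generalize (1 - 2 * γ) / γ = g
    field_simp
    ring
  rw [hlin, hpre, hsq, ← hbr]
  generalize (a + c * u) ^ (q - 1) = X
  generalize (a + c * u) ^ (2 - q) = Y
  rw [div_inv_eq_mul, mul_comm X u]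
  have hY : ∀ x z : ℝ, t ^ 3 * (x * (Y / (t * u)) * (u * z / t ^ 2)) = x * Y * z := fun x z => by
    field_simp
  have hZ : t ^ 3 * (9 / 2 * γ * v ^ 2 * ((a + c * u) / t) ^ 3) =
      9 / 2 * γ * v ^ 2 * (a + c * u) ^ 3 := by field_simp
  rw [← hY, ← hZ]
  ring

/-- For `q < 1`, the two-term truncation `H t = 2/(3γt) + c₂ t^{−q}` with subleading
coefficient `c₂ = (α/(γ(2−q)))(2/(3γ))^q` is eventually positive as `t → 0⁺` and
satisfies `t³ D[H] t → 0` as `t → 0⁺`. -/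
theorem stmt17 (γ v α k q : ℝ) (hγ₁ : 1 ≤ γ) (hγ₂ : γ ≤ 2) (hv₀ : 0 < v) (hv₁ : v < 1)
    (hα : 0 < α) (hk : 0 < k) (hq : q < 1) (c₂ : ℝ)
    (hc₂ : c₂ = (α / (γ * (2 - q))) * (2 / (3 * γ)) ^ q)
    (H : ℝ → ℝ) (hH : ∀ t : ℝ, H t = 2 / (3 * γ * t) + c₂ * t ^ (-q)) :
    (∀ᶠ t in nhdsWithin 0 (Set.Ioi (0 : ℝ)), 0 < H t) ∧
      Tendsto (fun t : ℝ => t ^ 3 * Dop γ v α k q H t)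
        (nhdsWithin 0 (Set.Ioi (0 : ℝ))) (nhds 0) := by
  have hγ : 0 < γ := by linarith
  have ha : 0 < 2 / (3 * γ) := by positivity
  have hq2 : 0 < 2 - q := by linarith
  have hc : 0 < c₂ := by rw [hc₂]; positivity
  constructor
  · filter_upwards [self_mem_nhdsWithin] with t ht
    have ht : 0 < t := ht
    rw [hH]
    positivity
  · have hu : Tendsto (fun t : ℝ => t ^ (1 - q)) (𝓝[>] 0) (𝓝 0) := by
      have h := (Real.continuousAt_rpow_const 0 (1 - q) (Or.inr (by linarith))).tendsto
      rw [Real.zero_rpow (by linarith)] at h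
      exact h.mono_left nhdsWithin_le_nhds
    have hF := (continuousAt_rescaledDop_zero (γ := γ) (v := v) (α := α) (k := k) (q := q)
      (c := c₂) ha).tendsto.comp hu
    rw [hc₂, rescaledDop_zero hγ hα hq, ← hc₂] at hF
    refine hF.congr' ?_
    filter_upwards [self_mem_nhdsWithin] with t ht
    refine (cube_mul_Dop_eq_rescaledDop ha hc (mul_div_cancel₀ 2 (by positivity)) ht fun s => ?_).symm
    rw [hH, div_div]
end

section
/- Assume 1 ≤ γ ≤ 2, 0 < v < 1, α > 0, k > 0, and q < 1. Set n₁ = 2/(q−3), n₂ = (1+q)/(q−3), c₁ = [9γ³v⁴(9 − 6q + q²)/(4k²α(γ − γq + 2))]^{1/(q−3)}, c₂ = (3((( q−1)γ − 2)v² + 4k²)·γ·(q−3) / (4k²(q−2)((q−1)γ − 4)))·[9γ³v⁴(9 − 6q + q²)/(4k²α(γ − γq + 2))]^{2/(q−3)}, and define H(t) = c₁·t^{n₁} + c₂·t^{n₂} for t > 0 (real exponentiation). Then n₂ > n₁, H(t) > 0 for all sufficiently small t > 0, and t^{(2q−8)/(q−3)}·D[H](t) → 0 as t → 0⁺. -/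
open Filter Topology

/-- The derivative of a sum of two powers on the positive half-line. -/
lemma deriv_two_powers (a b m n : ℝ) {t : ℝ} (ht : 0 < t) :
    deriv (fun x : ℝ => a * x ^ m + b * x ^ n) t =
      a * m * t ^ (m - 1) + b * n * t ^ (n - 1) := by
  have h₁ := (Real.hasDerivAt_rpow_const (p := m) (Or.inl ht.ne')).const_mul a
  have h₂ := (Real.hasDerivAt_rpow_const (p := n) (Or.inl ht.ne')).const_mul b
  rw [(h₁.fun_add h₂).deriv]
  ring

/-- The second derivative of a sum of two powers on the positive half-line. -/
lemma deriv_deriv_two_powers (a b m n : ℝ) {t : ℝ} (ht : 0 < t) :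
    deriv (deriv (fun x : ℝ => a * x ^ m + b * x ^ n)) t =
      a * m * (m - 1) * t ^ (m - 2) + b * n * (n - 1) * t ^ (n - 2) := by
  have h : deriv (fun x : ℝ => a * x ^ m + b * x ^ n) =ᶠ[𝓝 t]
      fun x => (a * m) * x ^ (m - 1) + (b * n) * x ^ (n - 1) := by
    filter_upwards [lt_mem_nhds ht] with x hx using deriv_two_powers a b m n hx
  rw [h.deriv_eq, deriv_two_powers _ _ _ _ ht]
  ring_nf

/-- The operator `Dop` on `t ↦ (c₁ s + c₂ s²) / t` with `s = t ^ δ`, multiplied by `t ^ 3` and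
written as a function of `s`. -/
noncomputable def reducedOp (γ v α k q c₁ c₂ n₁ n₂ s : ℝ) : ℝ :=
  ((1 - k ^ 2 / v ^ 2) * s -
      (2 * k ^ 2 / (3 * γ * v ^ 2)) * ((n₁ * c₁ + n₂ * c₂ * s) / (c₁ + c₂ * s) ^ 2)) *
      (n₁ * (n₁ - 1) * c₁ + n₂ * (n₂ - 1) * c₂ * s +
        3 * s * (c₁ + c₂ * s) * (n₁ * c₁ + n₂ * c₂ * s) +
        ((1 - 2 * γ) / γ) * ((n₁ * c₁ + n₂ * c₂ * s) ^ 2 / (c₁ + c₂ * s)) +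
        (9 / 4) * γ * s ^ 2 * (c₁ + c₂ * s) ^ 3) +
    (3 * γ * v ^ 2 / (2 * α)) *
      ((c₁ + c₂ * s) ^ (2 - q) + (α * k ^ 2 / (γ * v ^ 2)) * s ^ 2 * (c₁ + c₂ * s)) *
      (2 * (n₁ * c₁ + n₂ * c₂ * s) + 3 * γ * s * (c₁ + c₂ * s) ^ 2) -
    (9 / 2) * γ * v ^ 2 * s ^ 3 * (c₁ + c₂ * s) ^ 3

/-- The rescaled operator is the difference quotient of `reducedOp`. -/
lemma rpow_mul_Dop_eq (γ v α k q c₁ c₂ δ : ℝ) (hγ : γ ≠ 0) (hv : v ≠ 0) (hα : α ≠ 0)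
    (hδ : δ * (3 - q) = 1 - q) {t : ℝ} (ht : 0 < t) (hu : 0 < c₁ + c₂ * t ^ δ) :
    t ^ (3 - δ) * Dop γ v α k q (fun x => c₁ * x ^ (δ - 1) + c₂ * x ^ (2 * δ - 1)) t =
      reducedOp γ v α k q c₁ c₂ (δ - 1) (2 * δ - 1) (t ^ δ) / t ^ δ := by
  have hs : 0 < t ^ δ := Real.rpow_pos_of_pos ht δ
  have h2δ : t ^ (2 * δ) = (t ^ δ) ^ 2 := by
    rw [mul_comm, Real.rpow_mul ht.le, Real.rpow_two]
  have hpow (x : ℝ) (j : ℕ) : t ^ (x - j) = t ^ x / t ^ j := by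
    rw [Real.rpow_sub ht, Real.rpow_natCast]
  have hH : c₁ * t ^ (δ - 1) + c₂ * t ^ (2 * δ - 1) = t ^ δ * (c₁ + c₂ * t ^ δ) / t := by
    rw [Real.rpow_sub_one ht.ne', Real.rpow_sub_one ht.ne', h2δ]
    ring
  have hH' : deriv (fun x : ℝ => c₁ * x ^ (δ - 1) + c₂ * x ^ (2 * δ - 1)) t =
      t ^ δ * ((δ - 1) * c₁ + (2 * δ - 1) * c₂ * t ^ δ) / t ^ 2 := by
    have e₁ := hpow δ 2
    have e₂ := hpow (2 * δ) 2
    push_cast at e₁ e₂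
    rw [deriv_two_powers _ _ _ _ ht, show δ - 1 - 1 = δ - 2 by ring,
      show 2 * δ - 1 - 1 = 2 * δ - 2 by ring, e₁, e₂, h2δ]
    ring
  have hH'' : deriv (deriv (fun x : ℝ => c₁ * x ^ (δ - 1) + c₂ * x ^ (2 * δ - 1))) t =
      t ^ δ * ((δ - 1) * (δ - 1 - 1) * c₁ +
        (2 * δ - 1) * (2 * δ - 1 - 1) * c₂ * t ^ δ) / t ^ 3 := by
    have e₁ := hpow δ 3
    have e₂ := hpow (2 * δ) 3
    push_cast at e₁ e₂
    rw [deriv_deriv_two_powers _ _ _ _ ht, show δ - 1 - 2 = δ - 3 by ring,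
      show 2 * δ - 1 - 2 = 2 * δ - 3 by ring, e₁, e₂, h2δ]
    ring
  have hE : t ^ (3 - δ) = t ^ 3 / t ^ δ := by
    rw [Real.rpow_sub ht]
    norm_cast
  have hR : (t ^ δ * (c₁ + c₂ * t ^ δ) / t) ^ (2 - q) =
      (c₁ + c₂ * t ^ δ) ^ (2 - q) / (t * t ^ δ) := by
    rw [Real.div_rpow (by positivity) ht.le, Real.mul_rpow hs.le hu.le, ← Real.rpow_mul ht.le,
      show δ * (2 - q) = (2 - q) - 1 - δ by linear_combination hδ, Real.rpow_sub ht,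
      Real.rpow_sub_one ht.ne']
    have := (Real.rpow_pos_of_pos ht (2 - q)).ne'
    field_simp
  have hQ : (t ^ δ * (c₁ + c₂ * t ^ δ) / t) ^ (q - 1) =
      (t ^ δ * (c₁ + c₂ * t ^ δ) / t) / (t ^ δ * (c₁ + c₂ * t ^ δ) / t) ^ (2 - q) := by
    rw [show q - 1 = 1 - (2 - q) by ring, Real.rpow_sub (by positivity), Real.rpow_one]
  have hR₀ := Real.rpow_pos_of_pos hu (2 - q)
  unfold Dop reducedOp
  simp only [hH, hH', hH'', hE, hQ, hR]
  generalize (c₁ + c₂ * t ^ δ) ^ (2 - q) = R at *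
  generalize (δ - 1) * c₁ + (2 * δ - 1) * c₂ * t ^ δ = p
  generalize (δ - 1) * (δ - 1 - 1) * c₁ + (2 * δ - 1) * (2 * δ - 1 - 1) * c₂ * t ^ δ = w
  generalize c₁ + c₂ * t ^ δ = u at *
  generalize t ^ δ = s at *
  field_simp

/-- The value of the derivative of `reducedOp` at the origin. -/
lemma hasDerivAt_reducedOp_zero (γ v α k q c₁ c₂ n₁ n₂ : ℝ) (hc : 0 < c₁) :
    HasDerivAt (reducedOp γ v α k q c₁ c₂ n₁ n₂)
      (((1 - k ^ 2 / v ^ 2) - (2 * k ^ 2 / (3 * γ * v ^ 2)) * ((n₂ - 2 * n₁) * c₂ / c₁ ^ 2)) *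
          (n₁ * (n₁ - 1) * c₁ + ((1 - 2 * γ) / γ) * (n₁ ^ 2 * c₁)) -
        (2 * k ^ 2 / (3 * γ * v ^ 2)) * (n₁ / c₁) *
          (n₂ * (n₂ - 1) * c₂ + 3 * n₁ * c₁ ^ 2 +
            ((1 - 2 * γ) / γ) * ((2 * n₁ * n₂ - n₁ ^ 2) * c₂)) +
        (3 * γ * v ^ 2 / (2 * α)) *
          ((2 - q) * c₁ ^ (1 - q) * c₂ * (2 * n₁ * c₁) +
            c₁ ^ (2 - q) * (2 * n₂ * c₂ + 3 * γ * c₁ ^ 2))) 0 := by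
  have hs : HasDerivAt (fun s : ℝ => s) 1 0 := hasDerivAt_id 0
  have hu : HasDerivAt (fun s : ℝ => c₁ + c₂ * s) (c₂ * 1) 0 := (hs.const_mul c₂).const_add c₁
  have hp : HasDerivAt (fun s : ℝ => n₁ * c₁ + n₂ * c₂ * s) (n₂ * c₂ * 1) 0 :=
    (hs.const_mul _).const_add _
  have hw : HasDerivAt (fun s : ℝ => n₁ * (n₁ - 1) * c₁ + n₂ * (n₂ - 1) * c₂ * s)
      (n₂ * (n₂ - 1) * c₂ * 1) 0 := (hs.const_mul _).const_add _
  have hu₀ : c₁ + c₂ * 0 ≠ 0 := by simpa using hc.ne'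
  have hR := hu.rpow_const (p := 2 - q) (Or.inl hu₀)
  have hK := (hs.const_mul (1 - k ^ 2 / v ^ 2)).fun_sub
    ((hp.fun_div (hu.fun_pow 2) (pow_ne_zero 2 hu₀)).const_mul (2 * k ^ 2 / (3 * γ * v ^ 2)))
  have hE := ((hw.fun_add (((hs.const_mul 3).fun_mul hu).fun_mul hp)).fun_add
    (((hp.fun_pow 2).fun_div hu hu₀).const_mul ((1 - 2 * γ) / γ))).fun_add
    (((hs.fun_pow 2).const_mul (9 / 4 * γ)).fun_mul (hu.fun_pow 3))
  have hM := ((hR.fun_add (((hs.fun_pow 2).const_mul (α * k ^ 2 / (γ * v ^ 2))).fun_mul hu)).const_mul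
    (3 * γ * v ^ 2 / (2 * α))).fun_mul
    ((hp.const_mul 2).fun_add ((hs.const_mul (3 * γ)).fun_mul (hu.fun_pow 2)))
  have hL := ((hs.fun_pow 3).const_mul (9 / 2 * γ * v ^ 2)).fun_mul (hu.fun_pow 3)
  refine (((hK.fun_mul hE).fun_add hM).fun_sub hL).congr_deriv ?_
  have e : (2 : ℝ) - q - 1 = 1 - q := by ring
  simp only [e, mul_zero, add_zero]
  norm_num
  generalize c₁ ^ (1 - q) = P
  generalize c₁ ^ (2 - q) = Q
  generalize k ^ 2 / v ^ 2 = x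
  generalize 2 * k ^ 2 / (3 * γ * v ^ 2) = y
  generalize (1 - 2 * γ) / γ = z
  field_simp
  ring

/-- The stated coefficients annihilate `reducedOp` to second order at the origin. -/
lemma reducedOp_double_zero (γ v α k q c₁ C : ℝ) (hγ : 0 < γ) (hv : 0 < v) (hα : 0 < α)
    (hk : 0 < k) (hq : q < 1) (hc : 0 < c₁)
    (hL : c₁ ^ (3 - q) = 4 * k ^ 2 * α * (γ - γ * q + 2) /
      (9 * γ ^ 3 * v ^ 4 * (9 - 6 * q + q ^ 2)))
    (hC : C = 3 * (((q - 1) * γ - 2) * v ^ 2 + 4 * k ^ 2) * γ * (q - 3) /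
        (4 * k ^ 2 * (q - 2) * ((q - 1) * γ - 4))) :
    reducedOp γ v α k q c₁ (C * c₁ ^ 2) (2 / (q - 3)) ((1 + q) / (q - 3)) 0 = 0 ∧
    HasDerivAt (reducedOp γ v α k q c₁ (C * c₁ ^ 2) (2 / (q - 3)) ((1 + q) / (q - 3))) 0 0 := by
  have h₃ : q - 3 ≠ 0 := by linarith
  have h₂ : q - 2 ≠ 0 := by linarith
  have h₄ : (q - 1) * γ - 4 ≠ 0 := by nlinarith
  have h₅ : γ * (q - 1) - 4 ≠ 0 := by rwa [mul_comm γ]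
  have h₆ : 9 - 6 * q + q ^ 2 = (q - 3) ^ 2 := by ring
  rw [h₆] at hL
  have hP : c₁ ^ (1 - q) = c₁ ^ (3 - q) / c₁ ^ 2 := by
    rw [show 1 - q = 3 - q - (2 : ℕ) by push_cast; ring, Real.rpow_sub hc, Real.rpow_natCast]
  have hQ : c₁ ^ (2 - q) = c₁ ^ (3 - q) / c₁ := by
    rw [show 2 - q = 3 - q - 1 by ring, Real.rpow_sub_one hc.ne']
  constructor
  · unfold reducedOp
    simp only [mul_zero, add_zero, hQ, hL]
    field_simp
    ring
  · refine (hasDerivAt_reducedOp_zero γ v α k q c₁ (C * c₁ ^ 2) _ _ hc).congr_deriv ?_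
    rw [hP, hQ, hL, hC]
    field_simp
    ring

/-- For `q < 1`, the two-term truncation `H t = c₁ t^{2/(q−3)} + c₂ t^{(1+q)/(q−3)}`
with the stated coefficients satisfies `n₂ > n₁`, is eventually positive as `t → 0⁺`,
and `t^{(2q−8)/(q−3)} D[H] t → 0` as `t → 0⁺`. -/
theorem stmt19 (γ v α k q : ℝ) (hγ₁ : 1 ≤ γ) (hγ₂ : γ ≤ 2) (hv₀ : 0 < v) (hv₁ : v < 1)
    (hα : 0 < α) (hk : 0 < k) (hq : q < 1) (n₁ n₂ c₁ c₂ : ℝ)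
    (hn₁ : n₁ = 2 / (q - 3)) (hn₂ : n₂ = (1 + q) / (q - 3))
    (hc₁ : c₁ = (9 * γ ^ 3 * v ^ 4 * (9 - 6 * q + q ^ 2) /
        (4 * k ^ 2 * α * (γ - γ * q + 2))) ^ (1 / (q - 3)))
    (hc₂ : c₂ = (3 * (((q - 1) * γ - 2) * v ^ 2 + 4 * k ^ 2) * γ * (q - 3) /
        (4 * k ^ 2 * (q - 2) * ((q - 1) * γ - 4))) *
        (9 * γ ^ 3 * v ^ 4 * (9 - 6 * q + q ^ 2) /
          (4 * k ^ 2 * α * (γ - γ * q + 2))) ^ (2 / (q - 3)))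
    (H : ℝ → ℝ) (hH : ∀ t : ℝ, H t = c₁ * t ^ n₁ + c₂ * t ^ n₂) :
    n₂ > n₁ ∧
      (∀ᶠ t in nhdsWithin 0 (Set.Ioi (0 : ℝ)), 0 < H t) ∧
      Tendsto (fun t : ℝ => t ^ ((2 * q - 8) / (q - 3)) * Dop γ v α k q H t)
        (nhdsWithin 0 (Set.Ioi (0 : ℝ))) (nhds 0) := by
  have h₃ : q - 3 < 0 := by linarith
  set X : ℝ := 9 * γ ^ 3 * v ^ 4 * (9 - 6 * q + q ^ 2) / (4 * k ^ 2 * α * (γ - γ * q + 2)) with hX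
  have h₉ : 0 < 9 - 6 * q + q ^ 2 := by nlinarith
  have hden : 0 < γ - γ * q + 2 := by nlinarith
  have hγ : 0 < γ := by linarith
  have hX₀ : 0 < X := by positivity
  have hc : 0 < c₁ := hc₁ ▸ Real.rpow_pos_of_pos hX₀ _
  have hL : c₁ ^ (3 - q) = 4 * k ^ 2 * α * (γ - γ * q + 2) /
      (9 * γ ^ 3 * v ^ 4 * (9 - 6 * q + q ^ 2)) := by
    have h₃' := h₃.ne
    rw [hc₁, ← Real.rpow_mul hX₀.le, show 1 / (q - 3) * (3 - q) = -1 by field_simp; ring,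
      Real.rpow_neg_one, hX, inv_div]
  have hsq : X ^ (2 / (q - 3)) = c₁ ^ 2 := by
    rw [hc₁, ← Real.rpow_mul_natCast hX₀.le]
    congr 1
    push_cast
    ring
  rw [hsq] at hc₂
  obtain ⟨hF₀, hF⟩ := reducedOp_double_zero γ v α k q c₁ _ hγ hv₀ hα hk hq hc hL rfl
  rw [← hc₂, ← hn₁, ← hn₂] at hF₀ hF
  obtain ⟨δ, hδ⟩ : ∃ δ, δ = (q - 1) / (q - 3) := ⟨_, rfl⟩
  have hδ₀ : 0 < δ := hδ ▸ div_pos_of_neg_of_neg (by linarith) h₃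
  have hδq : δ * (3 - q) = 1 - q := by
    rw [hδ, div_mul_eq_mul_div, div_eq_iff h₃.ne]
    ring
  have e₁ : n₁ = δ - 1 := by
    rw [hn₁, hδ, eq_sub_iff_add_eq, div_add_one h₃.ne]
    congr 1
    ring
  have e₂ : n₂ = 2 * δ - 1 := by
    rw [hn₂, hδ]
    field_simp [h₃.ne]
    ring
  have e₃ : (2 * q - 8) / (q - 3) = 3 - δ := by
    rw [hδ]
    field_simp [h₃.ne]
    ring
  have hs₀ : Tendsto (fun t : ℝ => t ^ δ) (𝓝[>] 0) (𝓝 0) := by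
    have := (Real.continuousAt_rpow_const 0 δ (Or.inr hδ₀.le)).tendsto
    rw [Real.zero_rpow hδ₀.ne'] at this
    exact this.mono_left nhdsWithin_le_nhds
  have hs : Tendsto (fun t : ℝ => t ^ δ) (𝓝[>] 0) (𝓝[≠] 0) := by
    refine tendsto_nhdsWithin_iff.2 ⟨hs₀, ?_⟩
    filter_upwards [self_mem_nhdsWithin] with t ht using (Real.rpow_pos_of_pos ht δ).ne'
  have hu : ∀ᶠ t : ℝ in 𝓝[>] 0, 0 < c₁ + c₂ * t ^ δ := by
    have := (hs₀.const_mul c₂).const_add c₁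
    rw [mul_zero, add_zero] at this
    exact this.eventually_const_lt hc
  refine ⟨by linarith, ?_, ?_⟩
  · filter_upwards [self_mem_nhdsWithin, hu] with t ht hut
    have : c₁ * t ^ n₁ + c₂ * t ^ n₂ = t ^ n₁ * (c₁ + c₂ * t ^ δ) := by
      rw [show n₂ = n₁ + δ by linarith, Real.rpow_add ht]
      ring
    rw [hH, this]
    exact mul_pos (Real.rpow_pos_of_pos ht _) hut
  · refine ((hasDerivAt_iff_tendsto_slope.1 hF).comp hs).congr' ?_
    filter_upwards [self_mem_nhdsWithin, hu] with t ht hut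
    rw [funext hH, e₁, e₂, e₃,
      rpow_mul_Dop_eq γ v α k q c₁ c₂ δ hγ.ne' hv₀.ne' hα.ne' hδq ht hut, ← e₁, ← e₂,
      Function.comp_apply, slope_def_field, hF₀, sub_zero, sub_zero]
end
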